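/- arXiv:1701.03626 — 3 statements merged into one kernel-verified Lean document; each statement's English description precedes it below -/
import Mathlib

section
/- Let μ ∈ ℂ with Re μ < 1/2 and let ν ∈ (−1/2, −Re μ). Then for every x > 0 and every τ ∈ ℝ one has |Φ_τ(x)| ≤ C_{μ,ν} x^{−ν}, where C_{μ,ν} = (2^{2ν−1}/(π√π)) B(ν+1/2, ν+1/2) ∫_{−∞}^∞ |Γ(ν+1/2+it)² Γ(−μ−ν−it) / Γ(1+ν+it−μ)| dt and B denotes the Euler Beta function. -/
open MeasureTheory Set Complex

/-- The integrand of the Mellin–Barnes representation of the kernel `Φ_τ`. -/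
noncomputable def Kker (μ : ℂ) (τ : ℝ) (s : ℂ) : ℂ :=
  Complex.Gamma (s + 1/2 + Complex.I * (τ : ℂ)) *
    Complex.Gamma (s + 1/2 - Complex.I * (τ : ℂ)) *
    Complex.Gamma (s + 1/2) * Complex.Gamma (-μ - s) /
    (Complex.Gamma (1 + s) * Complex.Gamma (1 + s - μ))

/-- The kernel `Φ_τ(x)`, given as a Mellin–Barnes integral along the line `Re s = γ`. -/
noncomputable def Phi (μ : ℂ) (γ τ x : ℝ) : ℂ :=
  (1 / (2 * Real.pi)) •
    ∫ t : ℝ, Kker μ τ ((γ : ℂ) + (t : ℂ) * Complex.I) *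
      (x : ℂ) ^ (-((γ : ℂ) + (t : ℂ) * Complex.I))

/-- The constant `C_{μ,ν} = (2^{2ν−1}/(π√π)) B(ν+1/2, ν+1/2)
∫_{−∞}^∞ |Γ(ν+1/2+it)² Γ(−μ−ν−it) / Γ(1+ν+it−μ)| dt`, where the Euler Beta function is
`B(a,b) = Γ(a)Γ(b)/Γ(a+b)`. -/
noncomputable def Cconst (μ : ℂ) (ν : ℝ) : ℝ :=
  (2 : ℝ) ^ (2 * ν - 1) / (Real.pi * Real.sqrt Real.pi) *
    (Real.Gamma (ν + 1/2) * Real.Gamma (ν + 1/2) / Real.Gamma (ν + 1/2 + (ν + 1/2))) *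
    ∫ t : ℝ, ‖Complex.Gamma ((ν : ℂ) + 1/2 + (t : ℂ) * Complex.I) ^ 2 *
      Complex.Gamma (-μ - (ν : ℂ) - (t : ℂ) * Complex.I) /
      Complex.Gamma (1 + (ν : ℂ) + (t : ℂ) * Complex.I - μ)‖

namespace Complex

/-- The Beta integral bounds a product of Gamma values by its restriction to the real axis. -/
theorem norm_Gamma_mul_Gamma_le {u v : ℂ} (hu : 0 < u.re) (hv : 0 < v.re) :
    ‖Gamma u * Gamma v‖ ≤ ‖Gamma (u + v)‖ * ProbabilityTheory.beta u.re v.re := by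
  have hreal : betaIntegral u.re v.re =
      ((∫ x : ℝ in (0 : ℝ)..1, x ^ (u.re - 1) * (1 - x) ^ (v.re - 1) : ℝ) : ℂ) := by
    rw [betaIntegral, ← intervalIntegral.integral_ofReal]
    refine intervalIntegral.integral_congr fun x hx => ?_
    rw [uIcc_of_le zero_le_one] at hx
    simp only [ofReal_mul, ofReal_cpow hx.1, ofReal_cpow (sub_nonneg.2 hx.2), ofReal_sub,
      ofReal_one]
  have hle : ‖betaIntegral u v‖ ≤ ProbabilityTheory.beta u.re v.re := by
    rw [ProbabilityTheory.beta_eq_betaIntegralReal _ _ hu hv, hreal, ofReal_re, betaIntegral,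
      intervalIntegral.integral_of_le zero_le_one, intervalIntegral.integral_of_le zero_le_one,
      integral_Ioc_eq_integral_Ioo, integral_Ioc_eq_integral_Ioo]
    refine (norm_integral_le_integral_norm _).trans_eq
      (setIntegral_congr_fun measurableSet_Ioo fun x hx => ?_)
    have h1 : (1 - (x : ℂ)) = ((1 - x : ℝ) : ℂ) := by push_cast; rfl
    simp only [norm_mul]
    rw [h1, norm_cpow_eq_rpow_re_of_pos hx.1, norm_cpow_eq_rpow_re_of_pos (sub_pos.2 hx.2)]
    simp
  rw [Gamma_mul_Gamma_eq_betaIntegral hu hv, norm_mul]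
  gcongr

theorem norm_Gamma_sq_of_re_eq_half {z : ℂ} (hz : z.re = 1 / 2) :
    ‖Gamma z‖ ^ 2 = Real.pi / Real.cosh (Real.pi * z.im) := by
  have hz' : z = 1 / 2 + z.im * I := by
    apply Complex.ext <;> simp [hz]
  have hc : (1 : ℂ) - z = (starRingEnd ℂ) z := by
    apply Complex.ext <;> simp [hz]; norm_num
  have hsin : sin (Real.pi * z) = Real.cosh (Real.pi * z.im) := by
    have : (Real.pi : ℂ) * z = Real.pi * z.im * I + Real.pi / 2 := by
      conv_lhs => rw [hz']
      ring
    rw [this, sin_add_pi_div_two, cos_mul_I]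
    push_cast
    rfl
  have h := Gamma_mul_Gamma_one_sub z
  rw [hc, Gamma_conj, mul_conj, hsin, normSq_eq_norm_sq] at h
  exact_mod_cast h

theorem exists_norm_Gamma_le_of_re_eq_nat_add_half (n : ℕ) {c : ℝ} (hc : c < Real.pi / 2) :
    ∃ C, ∀ z : ℂ, z.re = n + 1 / 2 → ‖Gamma z‖ ≤ C * Real.exp (-(c * |z.im|)) := by
  induction n generalizing c with
  | zero =>
    refine ⟨√(2 * Real.pi), fun z hz => ?_⟩
    have hz : z.re = 1 / 2 := by simpa using hz
    refine le_of_sq_le_sq ?_ (by positivity)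
    rw [norm_Gamma_sq_of_re_eq_half hz, mul_pow, Real.sq_sqrt (by positivity), ← Real.exp_nat_mul,
      div_le_iff₀ (Real.cosh_pos _)]
    have h1 : Real.exp (Real.pi * |z.im|) ≤ 2 * Real.cosh (Real.pi * z.im) := by
      rw [← Real.cosh_abs, abs_mul, abs_of_pos Real.pi_pos, Real.cosh_eq]
      linarith [Real.exp_pos (-(Real.pi * |z.im|))]
    have h2 : 1 ≤ Real.exp (((2 : ℕ) : ℝ) * -(c * |z.im|)) * Real.exp (Real.pi * |z.im|) := by
      rw [← Real.exp_add, Real.one_le_exp_iff]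
      push_cast
      nlinarith [abs_nonneg z.im]
    nlinarith [Real.pi_pos, Real.exp_pos (((2 : ℕ) : ℝ) * -(c * |z.im|)),
      mul_le_mul_of_nonneg_left h1 (Real.exp_pos (((2 : ℕ) : ℝ) * -(c * |z.im|))).le]
  | succ n ih =>
    obtain ⟨d, hcd, hd⟩ := exists_between hc
    obtain ⟨C, hC⟩ := ih hd
    have hdc : 0 < d - c := sub_pos.2 hcd
    refine ⟨(n + 1 / 2 + 1 / (d - c)) * C, fun z hz => ?_⟩
    have hre : (z - 1).re = n + 1 / 2 := by simp [hz]; ring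
    have h1 : ‖Gamma (z - 1)‖ ≤ C * Real.exp (-(d * |z.im|)) := by
      simpa using hC (z - 1) hre
    have hne : z - 1 ≠ 0 := by
      intro h
      rw [h, zero_re] at hre
      linarith [n.cast_nonneg (α := ℝ)]
    have h2 : ‖z - 1‖ ≤ (n + 1 / 2 + 1 / (d - c)) * Real.exp ((d - c) * |z.im|) := by
      have h3 : ‖z - 1‖ ≤ (n + 1 / 2) + |z.im| := by
        have := norm_le_abs_re_add_abs_im (z - 1)
        rw [hre, abs_of_nonneg (by positivity)] at this
        simpa using this
      have h4 : |z.im| = 1 / (d - c) * ((d - c) * |z.im|) := by field_simp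
      have h5 := Real.add_one_le_exp ((d - c) * |z.im|)
      have h6 : 0 ≤ (d - c) * |z.im| := by positivity
      calc ‖z - 1‖ ≤ (n + 1 / 2) * 1 + 1 / (d - c) * ((d - c) * |z.im|) := by
            rw [← h4, mul_one]; exact h3
        _ ≤ (n + 1 / 2) * Real.exp ((d - c) * |z.im|)
            + 1 / (d - c) * Real.exp ((d - c) * |z.im|) := by
            gcongr <;> linarith
        _ = _ := by ring
    have h7 : Gamma z = (z - 1) * Gamma (z - 1) := by
      rw [← Gamma_add_one _ hne, sub_add_cancel]
    rw [h7, norm_mul]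
    calc ‖z - 1‖ * ‖Gamma (z - 1)‖
        ≤ ((n + 1 / 2 + 1 / (d - c)) * Real.exp ((d - c) * |z.im|)) *
          (C * Real.exp (-(d * |z.im|))) := by gcongr
      _ = (n + 1 / 2 + 1 / (d - c)) * C *
          (Real.exp ((d - c) * |z.im|) * Real.exp (-(d * |z.im|))) := by ring
      _ = _ := by rw [← Real.exp_add]; ring_nf

/-- Exponential decay of the Gamma function on vertical lines in the right half-plane. -/
theorem exists_norm_Gamma_le_of_re_eq {σ c : ℝ} (hσ : 0 < σ) (hc : c < Real.pi / 2) :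
    ∃ C, ∀ z : ℂ, z.re = σ → ‖Gamma z‖ ≤ C * Real.exp (-(c * |z.im|)) := by
  obtain ⟨n, hn⟩ := exists_nat_gt σ
  obtain ⟨C, hC⟩ := exists_norm_Gamma_le_of_re_eq_nat_add_half n hc
  set w : ℝ := n + 1 / 2 - σ with hw
  have hw0 : 0 < w := by linarith
  have hG : 0 < Real.Gamma w := Real.Gamma_pos_of_pos hw0
  have hB : 0 < ProbabilityTheory.beta σ w := ProbabilityTheory.beta_pos hσ hw0
  refine ⟨C * ProbabilityTheory.beta σ w / Real.Gamma w, fun z hz => ?_⟩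
  have h1 := norm_Gamma_mul_Gamma_le (u := z) (v := w) (by rwa [hz]) (by simpa using hw0)
  have h2 := hC (z + w) (by simp [hz, hw])
  rw [norm_mul, Gamma_ofReal, norm_real, Real.norm_of_nonneg hG.le, hz, ofReal_re] at h1
  have h3 : (z + w).im = z.im := by simp
  rw [h3] at h2
  rw [div_mul_eq_mul_div, le_div_iff₀ hG]
  calc _ ≤ _ := h1
    _ ≤ C * Real.exp (-(c * |z.im|)) * ProbabilityTheory.beta σ w := by gcongr
    _ = _ := by ring

theorem norm_sin_le_exp_abs_im (z : ℂ) : ‖sin z‖ ≤ Real.exp |z.im| := by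
  have h1 : ‖exp (-z * I)‖ ≤ Real.exp |z.im| := by
    rw [norm_exp]; simpa using le_abs_self z.im
  have h2 : ‖exp (z * I)‖ ≤ Real.exp |z.im| := by
    rw [norm_exp]; simpa using neg_le_abs z.im
  rw [sin, norm_div, norm_mul, norm_I, mul_one, norm_ofNat, div_le_iff₀ two_pos]
  linarith [norm_sub_le (exp (-z * I)) (exp (z * I))]

/-- Exponential bound for the reciprocal Gamma function on vertical lines in the right
half-plane. -/
theorem exists_inv_norm_Gamma_le_of_re_eq {σ c : ℝ} (hσ : 0 < σ) (hc : c < Real.pi / 2) :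
    ∃ C, ∀ z : ℂ, z.re = σ → ‖Gamma z‖⁻¹ ≤ C * Real.exp ((Real.pi - c) * |z.im|) := by
  obtain ⟨δ, hδ0, hδ⟩ := exists_between (lt_min hσ one_pos)
  obtain ⟨hδσ, hδ1⟩ := lt_min_iff.1 hδ
  obtain ⟨C, hC⟩ := exists_norm_Gamma_le_of_re_eq (sub_pos.2 hδ1) hc
  have hs : 0 < σ - δ := sub_pos.2 hδσ
  have hG : 0 < Real.Gamma (σ - δ) := Real.Gamma_pos_of_pos hs
  have hB : 0 < ProbabilityTheory.beta δ (σ - δ) := ProbabilityTheory.beta_pos hδ0 hs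
  refine ⟨ProbabilityTheory.beta δ (σ - δ) / Real.Gamma (σ - δ) * (C / Real.pi), fun z hz => ?_⟩
  set u : ℂ := z - (σ - δ : ℝ) with hu
  have hure : u.re = δ := by simp [hu, hz]
  have huim : u.im = z.im := by simp [hu]
  have hz0 : 0 < ‖Gamma z‖ := norm_pos_iff.2 (Gamma_ne_zero_of_re_pos (by rwa [hz]))
  have hu0 : 0 < ‖Gamma u‖ := norm_pos_iff.2 (Gamma_ne_zero_of_re_pos (by rwa [hure]))
  have h1 := norm_Gamma_mul_Gamma_le (u := u) (v := (σ - δ : ℝ)) (by rwa [hure])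
    (by simpa using hδσ)
  rw [norm_mul, Gamma_ofReal, norm_real, Real.norm_of_nonneg hG.le, hure, ofReal_re, hu,
    sub_add_cancel, ← hu] at h1
  have h2 : ‖Gamma z‖⁻¹ ≤
      ProbabilityTheory.beta δ (σ - δ) / Real.Gamma (σ - δ) * ‖Gamma u‖⁻¹ := by
    rw [← div_eq_mul_inv, div_div, inv_eq_one_div, div_le_div_iff₀ hz0 (by positivity)]
    linarith
  have hv : ‖Gamma (1 - u)‖ ≤ C * Real.exp (-(c * |z.im|)) := by
    simpa [huim] using hC (1 - u) (by simp [hure])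
  have hv0 : Gamma (1 - u) ≠ 0 := Gamma_ne_zero_of_re_pos (by simpa [hure] using hδ1)
  have hrefl := Gamma_mul_Gamma_one_sub u
  have hsin0 : sin (Real.pi * u) ≠ 0 := by
    intro h
    rw [h, div_zero] at hrefl
    exact mul_ne_zero (norm_pos_iff.1 hu0) hv0 hrefl
  have h3 : ‖Gamma u‖⁻¹ = ‖Gamma (1 - u)‖ * ‖sin (Real.pi * u)‖ / Real.pi := by
    have h4 : ‖Gamma u‖ * ‖Gamma (1 - u)‖ = Real.pi / ‖sin (Real.pi * u)‖ := by
      rw [← norm_mul, hrefl, norm_div, norm_real, Real.norm_of_nonneg Real.pi_pos.le]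
    rw [eq_div_iff (norm_ne_zero_iff.2 hsin0)] at h4
    rw [inv_eq_iff_eq_inv, inv_div, eq_div_iff
      (mul_ne_zero (norm_ne_zero_iff.2 hv0) (norm_ne_zero_iff.2 hsin0)), ← mul_assoc, h4]
  have h5 : ‖sin (Real.pi * u)‖ ≤ Real.exp (Real.pi * |z.im|) := by
    have := norm_sin_le_exp_abs_im (Real.pi * u)
    rwa [im_ofReal_mul, huim, abs_mul, abs_of_pos Real.pi_pos] at this
  calc ‖Gamma z‖⁻¹ ≤ ProbabilityTheory.beta δ (σ - δ) / Real.Gamma (σ - δ) *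
        (‖Gamma (1 - u)‖ * ‖sin (Real.pi * u)‖ / Real.pi) := by rw [← h3]; exact h2
    _ ≤ ProbabilityTheory.beta δ (σ - δ) / Real.Gamma (σ - δ) *
        (C * Real.exp (-(c * |z.im|)) * Real.exp (Real.pi * |z.im|) / Real.pi) := by
        have := (norm_nonneg _).trans hv
        gcongr
    _ = ProbabilityTheory.beta δ (σ - δ) / Real.Gamma (σ - δ) * (C / Real.pi) *
        (Real.exp (-(c * |z.im|)) * Real.exp (Real.pi * |z.im|)) := by ring
    _ = _ := by rw [← Real.exp_add]; ring_nf

theorem continuousAt_Gamma_of_re_pos {z : ℂ} (hz : 0 < z.re) : ContinuousAt Gamma z := by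
  refine (differentiableAt_Gamma z fun m hm => ?_).continuousAt
  rw [hm, neg_re, natCast_re] at hz
  linarith [m.cast_nonneg (α := ℝ)]

end Complex

theorem integrable_exp_neg_mul_abs {b : ℝ} (hb : 0 < b) :
    Integrable fun t : ℝ => Real.exp (-(b * |t|)) := by
  rw [← integrableOn_univ, ← Iic_union_Ioi (a := (0 : ℝ)), integrableOn_union]
  constructor
  · refine (integrableOn_exp_mul_Iic hb 0).congr_fun (fun t ht => ?_) measurableSet_Iic
    simp [abs_of_nonpos (mem_Iic.1 ht)]
  · refine (integrableOn_exp_mul_Ioi (neg_lt_zero.2 hb) 0).congr_fun (fun t ht => ?_)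
      measurableSet_Ioi
    simp [abs_of_pos (mem_Ioi.1 ht)]

theorem integrable_Cconst_integrand {μ : ℂ} {ν : ℝ} (hν : ν ∈ Set.Ioo (-(1/2) : ℝ) (-μ.re)) :
    Integrable fun t : ℝ => ‖Complex.Gamma ((ν : ℂ) + 1/2 + (t : ℂ) * Complex.I) ^ 2 *
      Complex.Gamma (-μ - (ν : ℂ) - (t : ℂ) * Complex.I) /
      Complex.Gamma (1 + (ν : ℂ) + (t : ℂ) * Complex.I - μ)‖ := by
  obtain ⟨hν1, hν2⟩ := hν
  have h1 : 0 < ν + 1 / 2 := by linarith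
  have h2 : 0 < -μ.re - ν := by linarith
  have h3 : 0 < 1 + ν - μ.re := by linarith
  have hre1 (t : ℝ) : ((ν : ℂ) + 1/2 + (t : ℂ) * Complex.I).re = ν + 1 / 2 := by simp
  have hre2 (t : ℝ) : (-μ - (ν : ℂ) - (t : ℂ) * Complex.I).re = -μ.re - ν := by simp
  have hre3 (t : ℝ) : (1 + (ν : ℂ) + (t : ℂ) * Complex.I - μ).re = 1 + ν - μ.re := by simp
  have hc : (1 : ℝ) < Real.pi / 2 := by linarith [Real.pi_gt_three]
  obtain ⟨A, hA⟩ := Complex.exists_norm_Gamma_le_of_re_eq h1 hc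
  obtain ⟨B, hB⟩ := Complex.exists_norm_Gamma_le_of_re_eq h2 hc
  obtain ⟨D, hD⟩ := Complex.exists_inv_norm_Gamma_le_of_re_eq h3 hc
  refine ((integrable_exp_neg_mul_abs (b := 4 - Real.pi)
    (by linarith [Real.pi_lt_four])).const_mul
    (A ^ 2 * B * D * Real.exp (Real.pi * |μ.im|))).mono'
    (Continuous.aestronglyMeasurable ?_) (ae_of_all _ fun t => ?_)
  · rw [continuous_iff_continuousAt]
    intro t
    have hG1 : ContinuousAt (fun t : ℝ => Complex.Gamma ((ν : ℂ) + 1/2 + (t : ℂ) * Complex.I)) t :=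
      ContinuousAt.comp (Complex.continuousAt_Gamma_of_re_pos (by rwa [hre1])) (by fun_prop)
    have hG2 : ContinuousAt (fun t : ℝ => Complex.Gamma (-μ - (ν : ℂ) - (t : ℂ) * Complex.I)) t :=
      ContinuousAt.comp (Complex.continuousAt_Gamma_of_re_pos (by rwa [hre2])) (by fun_prop)
    have hG3 : ContinuousAt (fun t : ℝ => Complex.Gamma (1 + (ν : ℂ) + (t : ℂ) * Complex.I - μ)) t :=
      ContinuousAt.comp (Complex.continuousAt_Gamma_of_re_pos (by rwa [hre3])) (by fun_prop)
    exact (((hG1.pow 2).mul hG2).div hG3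
      (Complex.Gamma_ne_zero_of_re_pos (by rwa [hre3]))).norm
  · have b1 := hA _ (hre1 t)
    have b2 := hB _ (hre2 t)
    have b3 := hD _ (hre3 t)
    have i1 : ((ν : ℂ) + 1/2 + (t : ℂ) * Complex.I).im = t := by simp
    have i2 : (-μ - (ν : ℂ) - (t : ℂ) * Complex.I).im = -μ.im - t := by simp
    have i3 : (1 + (ν : ℂ) + (t : ℂ) * Complex.I - μ).im = t - μ.im := by simp
    rw [i1] at b1
    rw [i2] at b2
    rw [i3] at b3
    have hA0 : 0 ≤ A := nonneg_of_mul_nonneg_left ((norm_nonneg _).trans b1) (Real.exp_pos _)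
    have hB0 : 0 ≤ B := nonneg_of_mul_nonneg_left ((norm_nonneg _).trans b2) (Real.exp_pos _)
    have hD0 : 0 ≤ D :=
      nonneg_of_mul_nonneg_left ((inv_nonneg.2 (norm_nonneg _)).trans b3) (Real.exp_pos _)
    rw [norm_norm, norm_div, norm_mul, norm_pow, div_eq_mul_inv]
    calc _ ≤ (A * Real.exp (-(1 * |t|))) ^ 2 * (B * Real.exp (-(1 * |-μ.im - t|))) *
          (D * Real.exp ((Real.pi - 1) * |t - μ.im|)) := by gcongr
      _ = A ^ 2 * B * D * Real.exp (-2 * |t| - |-μ.im - t| + (Real.pi - 1) * |t - μ.im|) := by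
        rw [show -2 * |t| - |-μ.im - t| + (Real.pi - 1) * |t - μ.im| =
          -(1 * |t|) + -(1 * |t|) + -(1 * |-μ.im - t|) + (Real.pi - 1) * |t - μ.im| by ring]
        simp only [Real.exp_add]
        ring
      _ ≤ A ^ 2 * B * D * Real.exp (Real.pi * |μ.im| + -((4 - Real.pi) * |t|)) := by
        refine mul_le_mul_of_nonneg_left (Real.exp_le_exp.2 ?_) (by positivity)
        have e1 : |t| - |μ.im| ≤ |-μ.im - t| := by
          have := abs_sub_abs_le_abs_sub t (-μ.im)
          rwa [abs_neg, abs_sub_comm] at this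
        have e2 : |t - μ.im| ≤ |t| + |μ.im| := abs_sub _ _
        nlinarith [mul_le_mul_of_nonneg_left e2 (by linarith [Real.pi_gt_three] : 0 ≤ Real.pi - 1)]
      _ = _ := by rw [Real.exp_add]; ring

/-- The pointwise form of the bound: Beta estimate followed by Legendre duplication. -/
theorem norm_Kker_le {μ : ℂ} {ν : ℝ} (hν : -(1/2) < ν) (τ t : ℝ) :
    ‖Kker μ τ ((ν : ℂ) + (t : ℂ) * Complex.I)‖ ≤
      (2 : ℝ) ^ (2 * ν) / Real.sqrt Real.pi *
        (Real.Gamma (ν + 1/2) * Real.Gamma (ν + 1/2) / Real.Gamma (ν + 1/2 + (ν + 1/2))) *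
      ‖Complex.Gamma ((ν : ℂ) + 1/2 + (t : ℂ) * Complex.I) ^ 2 *
        Complex.Gamma (-μ - (ν : ℂ) - (t : ℂ) * Complex.I) /
        Complex.Gamma (1 + (ν : ℂ) + (t : ℂ) * Complex.I - μ)‖ := by
  set s : ℂ := (ν : ℂ) + (t : ℂ) * Complex.I with hs
  have hν' : 0 < ν + 1 / 2 := by linarith
  have hsre : s.re = ν := by simp [hs]
  have hu : (s + 1/2 + Complex.I * (τ : ℂ)).re = ν + 1/2 := by simp [hsre]
  have hv : (s + 1/2 - Complex.I * (τ : ℂ)).re = ν + 1/2 := by simp [hsre]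
  have hbeta := Complex.norm_Gamma_mul_Gamma_le
    (u := s + 1/2 + Complex.I * (τ : ℂ)) (v := s + 1/2 - Complex.I * (τ : ℂ))
    (by rwa [hu]) (by rwa [hv])
  rw [hu, hv, show s + 1/2 + Complex.I * (τ : ℂ) + (s + 1/2 - Complex.I * (τ : ℂ)) =
    2 * (s + 1/2) by ring] at hbeta
  have hdup : ‖Complex.Gamma (2 * (s + 1/2))‖ = (2 : ℝ) ^ (2 * ν) / Real.sqrt Real.pi *
      (‖Complex.Gamma (s + 1/2)‖ * ‖Complex.Gamma (1 + s)‖) := by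
    have h := congrArg norm (Complex.Gamma_mul_Gamma_add_half (s + 1/2))
    have h2 : ‖(2 : ℂ) ^ (1 - 2 * (s + 1/2))‖ = ((2 : ℝ) ^ (2 * ν))⁻¹ := by
      have := Complex.norm_cpow_eq_rpow_re_of_pos two_pos (1 - 2 * (s + 1/2))
      rw [Complex.ofReal_ofNat] at this
      rw [this, ← Real.rpow_neg two_pos.le]
      congr 1
      simp [hsre]
      ring
    rw [norm_mul, norm_mul, norm_mul, h2, Complex.norm_real,
      Real.norm_of_nonneg (Real.sqrt_nonneg _), show s + 1/2 + 1/2 = 1 + s by ring] at h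
    have hp : 0 < Real.sqrt Real.pi := Real.sqrt_pos.2 Real.pi_pos
    have hq : 0 < (2 : ℝ) ^ (2 * ν) := by positivity
    rw [h]
    field_simp
  have h1s : 0 < ‖Complex.Gamma (1 + s)‖ :=
    norm_pos_iff.2 (Complex.Gamma_ne_zero_of_re_pos (by simp [hsre]; linarith))
  rw [show (ν : ℂ) + 1/2 + (t : ℂ) * Complex.I = s + 1/2 by rw [hs]; ring,
    show -μ - (ν : ℂ) - (t : ℂ) * Complex.I = -μ - s by rw [hs]; ring,
    show 1 + (ν : ℂ) + (t : ℂ) * Complex.I - μ = 1 + s - μ by rw [hs]; ring]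
  rw [hdup] at hbeta
  simp only [Kker, norm_div, norm_mul, norm_pow] at hbeta ⊢
  calc _ ≤ (2 : ℝ) ^ (2 * ν) / Real.sqrt Real.pi *
        (‖Complex.Gamma (s + 1/2)‖ * ‖Complex.Gamma (1 + s)‖) *
        ProbabilityTheory.beta (ν + 1/2) (ν + 1/2) * ‖Complex.Gamma (s + 1/2)‖ *
        ‖Complex.Gamma (-μ - s)‖ / (‖Complex.Gamma (1 + s)‖ * ‖Complex.Gamma (1 + s - μ)‖) := by
        gcongr
    _ = (2 : ℝ) ^ (2 * ν) / Real.sqrt Real.pi * ProbabilityTheory.beta (ν + 1/2) (ν + 1/2) *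
        (‖Complex.Gamma (s + 1/2)‖ ^ 2 * ‖Complex.Gamma (-μ - s)‖ /
          ‖Complex.Gamma (1 + s - μ)‖) * (‖Complex.Gamma (1 + s)‖ / ‖Complex.Gamma (1 + s)‖) := by
        ring
    _ = _ := by rw [div_self h1s.ne', mul_one, ProbabilityTheory.beta]

theorem stmt3 (μ : ℂ) (hμ : μ.re < 1/2) (ν : ℝ)
    (hν : ν ∈ Set.Ioo (-(1/2) : ℝ) (-μ.re)) :
    ∀ x : ℝ, 0 < x → ∀ τ : ℝ, ‖Phi μ ν τ x‖ ≤ Cconst μ ν * x ^ (-ν) := by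
  intro x hx τ
  set K : ℝ := (2 : ℝ) ^ (2 * ν) / Real.sqrt Real.pi *
    (Real.Gamma (ν + 1/2) * Real.Gamma (ν + 1/2) / Real.Gamma (ν + 1/2 + (ν + 1/2))) with hK
  have hbound := norm_integral_le_of_norm_le
    (((integrable_Cconst_integrand hν).const_mul K).mul_const (x ^ (-ν)))
    (f := fun t : ℝ => Kker μ τ ((ν : ℂ) + (t : ℂ) * Complex.I) *
      (x : ℂ) ^ (-((ν : ℂ) + (t : ℂ) * Complex.I)))
    (ae_of_all _ fun t => by
      rw [norm_mul, Complex.norm_cpow_eq_rpow_re_of_pos hx]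
      have hre : (-((ν : ℂ) + (t : ℂ) * Complex.I)).re = -ν := by simp
      rw [hre]
      gcongr
      exact norm_Kker_le hν.1 τ t)
  rw [integral_mul_const, integral_const_mul] at hbound
  have hπ := Real.pi_pos
  rw [Phi, norm_smul, Real.norm_of_nonneg (by positivity)]
  refine (mul_le_mul_of_nonneg_left hbound (by positivity)).trans_eq ?_
  rw [Cconst, hK, Real.rpow_sub_one two_ne_zero]
  ring
end

section
/- Let μ ∈ ℂ with Re μ < 1/2, let 1 < p ≤ 2, q = p/(p−1), and let ν ∈ (−1/(2q), min(0, −Re μ)). Let f : (0,∞) → ℂ be measurable with ∫₀^∞ |f(y)| y^{−ν} dy < ∞ and f ∈ L_{1−ν,p}(ℝ₊). Then for every τ ∈ ℝ, (F_μ f)(τ) = (1/(2πi)) ∫_{ν+1/2−i∞}^{ν+1/2+i∞} [Γ(s+iτ) Γ(s−iτ) Γ(s) Γ(1/2−μ−s) / (Γ(1/2+s) Γ(1/2+s−μ))] f*(3/2−s) ds, where f*(w) = ∫₀^∞ f(x) x^{w−1} dx is the Mellin transform of f (which converges absolutely for Re w = 1−ν). -/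
open MeasureTheory Set Complex

/-- The index transform `(F_μ f)(τ) = ∫₀^∞ Φ_τ(y) f(y) dy`. -/
noncomputable def Fmu (μ : ℂ) (γ : ℝ) (f : ℝ → ℂ) (τ : ℝ) : ℂ :=
  ∫ y in Set.Ioi (0 : ℝ), Phi μ γ τ y * f y

/-- On the right half-plane the Gamma function is bounded on vertical lines. -/
theorem norm_Gamma_le_Gamma_re {u : ℂ} (hu : 0 < u.re) :
    ‖Complex.Gamma u‖ ≤ Real.Gamma u.re := by
  rw [Complex.Gamma_eq_integral hu, Complex.GammaIntegral, Real.Gamma_eq_integral hu]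
  refine (norm_integral_le_integral_norm _).trans_eq ?_
  refine setIntegral_congr_fun measurableSet_Ioi fun x hx => ?_
  have hx' : (0 : ℝ) < x := hx
  simp only [norm_mul, Complex.norm_cpow_eq_rpow_re_of_pos hx', Complex.norm_real,
    Real.norm_eq_abs, Real.abs_exp, Complex.sub_re, Complex.one_re]

/-- The Gamma function decays at least quadratically on vertical lines of the right half-plane. -/
theorem norm_Gamma_le_div_normSq {u : ℂ} (hu : 0 < u.re) :
    ‖Complex.Gamma u‖ ≤ Real.Gamma (u.re + 2) / (u.re ^ 2 + u.im ^ 2) := by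
  have hu0 : u ≠ 0 := by rintro rfl; simp at hu
  have hu1 : u + 1 ≠ 0 := by
    intro h
    have := congrArg Complex.re h
    simp only [Complex.add_re, Complex.one_re, Complex.zero_re] at this
    linarith
  have h2 : Complex.Gamma (u + 2) = (u + 1) * (u * Complex.Gamma u) := by
    rw [← Complex.Gamma_add_one u hu0, ← Complex.Gamma_add_one (u + 1) hu1]
    congr 1
    ring
  have hle : ‖Complex.Gamma (u + 2)‖ ≤ Real.Gamma (u.re + 2) := by
    simpa using norm_Gamma_le_Gamma_re (u := u + 2) (by simp; linarith)
  have hsq : u.re ^ 2 + u.im ^ 2 = ‖u‖ ^ 2 := by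
    rw [← Complex.normSq_eq_norm_sq, Complex.normSq_apply]; ring
  have hmono : ‖u‖ ≤ ‖u + 1‖ := by
    rw [← sq_le_sq₀ (norm_nonneg _) (norm_nonneg _), ← Complex.normSq_eq_norm_sq,
      ← Complex.normSq_eq_norm_sq, Complex.normSq_apply, Complex.normSq_apply]
    simp only [Complex.add_re, Complex.one_re, Complex.add_im, Complex.one_im]
    nlinarith
  rw [hsq, le_div_iff₀ (by positivity)]
  refine le_trans ?_ hle
  rw [h2, norm_mul, norm_mul]
  calc ‖Complex.Gamma u‖ * ‖u‖ ^ 2 = ‖u‖ * (‖u‖ * ‖Complex.Gamma u‖) := by ring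
    _ ≤ ‖u + 1‖ * (‖u‖ * ‖Complex.Gamma u‖) := by gcongr

/-- The quotient `Γ(u) / Γ(u + v)` is bounded on vertical lines of the right half-plane. -/
theorem exists_norm_Gamma_div_Gamma_add_le {v : ℂ} (hv : 0 < v.re) {σ : ℝ} (hσ : 0 < σ) :
    ∃ C : ℝ, ∀ u : ℂ, u.re = σ → ‖Complex.Gamma u / Complex.Gamma (u + v)‖ ≤ C := by
  refine ⟨(∫ x in (0 : ℝ)..1, ‖(x : ℂ) ^ ((σ : ℂ) - 1) * (1 - (x : ℂ)) ^ (v - 1)‖) /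
    ‖Complex.Gamma v‖, fun u hu => ?_⟩
  have hu0 : 0 < u.re := hu ▸ hσ
  have hv0 : Complex.Gamma v ≠ 0 := Complex.Gamma_ne_zero_of_re_pos hv
  have heq : Complex.Gamma u / Complex.Gamma (u + v) =
      Complex.betaIntegral u v / Complex.Gamma v := by
    rw [Complex.betaIntegral_eq_Gamma_mul_div u v hu0 hv]
    field_simp
  rw [heq, norm_div]
  gcongr
  refine (intervalIntegral.norm_integral_le_integral_norm zero_le_one).trans_eq ?_
  refine intervalIntegral.integral_congr_ae (Filter.Eventually.of_forall fun x hx => ?_)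
  rw [uIoc_of_le zero_le_one] at hx
  simp only [norm_mul, Complex.norm_cpow_eq_rpow_re_of_pos hx.1, Complex.sub_re, hu,
    Complex.ofReal_re]

/-- Continuity of `t ↦ Γ(g t)` when `g` stays in the right half-plane. -/
theorem continuous_Gamma_comp {g : ℝ → ℂ} (hg : Continuous g) (hpos : ∀ t, 0 < (g t).re) :
    Continuous fun t => Complex.Gamma (g t) := by
  refine continuous_iff_continuousAt.2 fun t => ?_
  refine ContinuousAt.comp (f := g) (g := Complex.Gamma) ?_ hg.continuousAt
  refine (Complex.differentiableAt_Gamma _ fun m hm => ?_).continuousAt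
  have h := hpos t
  rw [hm, Complex.neg_re, Complex.natCast_re] at h
  have : (0 : ℝ) ≤ m := m.cast_nonneg
  linarith

/-- The Mellin–Barnes integrand is absolutely integrable on the line `Re s = ν`. -/
theorem integrable_Kker {μ : ℂ} {ν : ℝ} (hν : -(1/2) < ν)
    (hν' : ν < -μ.re) (τ : ℝ) :
    Integrable fun t : ℝ => Kker μ τ ((ν : ℂ) + (t : ℂ) * Complex.I) := by
  have hσ : 0 < ν + 1/2 := by linarith
  have hτ : (0 : ℝ) < (1/2 - μ - Complex.I * (τ : ℂ)).re := by simp; linarith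
  obtain ⟨C₁, hC₁⟩ := exists_norm_Gamma_div_Gamma_add_le hτ hσ
  obtain ⟨C₂, hC₂⟩ := exists_norm_Gamma_div_Gamma_add_le (v := 1/2) (by norm_num) hσ
  set s : ℝ → ℂ := fun t => (ν : ℂ) + (t : ℂ) * Complex.I with hs
  have hsc : Continuous s := by fun_prop
  have h1 : ∀ t, (s t + 1/2 + Complex.I * (τ : ℂ)).re = ν + 1/2 := fun t => by simp [hs]
  have h2 : ∀ t, (s t + 1/2 - Complex.I * (τ : ℂ)).re = ν + 1/2 := fun t => by simp [hs]
  have h3 : ∀ t, (s t + 1/2).re = ν + 1/2 := fun t => by simp [hs]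
  have h4 : ∀ t, (-μ - s t).re = -μ.re - ν := fun t => by simp [hs]
  have h5 : ∀ t, (1 + s t).re = 1 + ν := fun t => by simp [hs]
  have h6 : ∀ t, (1 + s t - μ).re = 1 + ν - μ.re := fun t => by simp [hs]
  have hcont : Continuous fun t => Kker μ τ (s t) := by
    unfold Kker
    refine Continuous.div ?_ ?_ fun t => ?_
    · refine ((Continuous.mul ?_ ?_).mul ?_).mul ?_
      · exact continuous_Gamma_comp (by fun_prop) fun t => by rw [h1]; exact hσ
      · exact continuous_Gamma_comp (by fun_prop) fun t => by rw [h2]; exact hσ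
      · exact continuous_Gamma_comp (by fun_prop) fun t => by rw [h3]; exact hσ
      · exact continuous_Gamma_comp (by fun_prop) fun t => by rw [h4]; linarith
    · refine Continuous.mul ?_ ?_
      · exact continuous_Gamma_comp (by fun_prop) fun t => by rw [h5]; linarith
      · exact continuous_Gamma_comp (by fun_prop) fun t => by rw [h6]; linarith
    · refine mul_ne_zero ?_ ?_
      · exact Complex.Gamma_ne_zero_of_re_pos (by rw [h5]; linarith)
      · exact Complex.Gamma_ne_zero_of_re_pos (by rw [h6]; linarith)
  have hdom : Integrable fun t : ℝ =>
      C₁ * C₂ * Real.Gamma (-μ.re - ν) * Real.Gamma (ν + 1/2 + 2) *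
        ((ν + 1/2) ^ 2 + (t - τ) ^ 2)⁻¹ := by
    have h := ((integrable_inv_one_add_sq.comp_div hσ.ne').comp_sub_right τ).const_mul
      (((ν + 1/2) ^ 2)⁻¹)
    refine (h.congr (Filter.Eventually.of_forall fun t => ?_)).const_mul _
    simp only
    rw [← mul_inv]
    rw [mul_add, mul_one, div_pow, mul_div_cancel₀ _ (pow_ne_zero 2 hσ.ne')]
  refine hdom.mono' hcont.aestronglyMeasurable (Filter.Eventually.of_forall fun t => ?_)
  have e : Kker μ τ (s t) =
      Complex.Gamma (s t + 1/2 + Complex.I * (τ : ℂ)) /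
          Complex.Gamma (s t + 1/2 + Complex.I * (τ : ℂ) + (1/2 - μ - Complex.I * (τ : ℂ))) *
        (Complex.Gamma (s t + 1/2) / Complex.Gamma (s t + 1/2 + 1/2)) *
        Complex.Gamma (-μ - s t) * Complex.Gamma (s t + 1/2 - Complex.I * (τ : ℂ)) := by
    rw [show s t + 1/2 + Complex.I * (τ : ℂ) + (1/2 - μ - Complex.I * (τ : ℂ)) = 1 + s t - μ by
      ring, show s t + 1/2 + 1/2 = 1 + s t by ring]
    unfold Kker
    rw [div_mul_div_comm, div_mul_eq_mul_div, div_mul_eq_mul_div]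
    congr 1 <;> ring
  have b1 := hC₁ _ (h1 t)
  have b2 := hC₂ _ (h3 t)
  have b3 := norm_Gamma_le_Gamma_re (u := -μ - s t) (by rw [h4]; linarith)
  have b4 := norm_Gamma_le_div_normSq (u := s t + 1/2 - Complex.I * (τ : ℂ)) (by rw [h2]; exact hσ)
  rw [h4] at b3
  rw [h2, show (s t + 1/2 - Complex.I * (τ : ℂ)).im = t - τ by simp [hs]] at b4
  rw [e, norm_mul, norm_mul, norm_mul, mul_assoc _ (Real.Gamma (ν + 1/2 + 2)), ← div_eq_mul_inv]
  have c1 : 0 ≤ C₁ := (norm_nonneg _).trans b1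
  have c2 : 0 ≤ C₂ := (norm_nonneg _).trans b2
  have c3 := (norm_nonneg _).trans b3
  gcongr

/-- A vertical-line Mellin–Barnes integral may be integrated against `f` under the integral
sign. -/
theorem integral_mul_cpow_mul_eq_integral_mul_mellin {K : ℝ → ℂ} (hK : Integrable K) {ν : ℝ}
    {f : ℝ → ℂ} (hfm : AEStronglyMeasurable f (volume.restrict (Ioi (0 : ℝ))))
    (hf : IntegrableOn (fun y : ℝ => ‖f y‖ * y ^ (-ν)) (Ioi (0 : ℝ))) :
    ∫ y in Ioi (0 : ℝ), (∫ t : ℝ, K t * (y : ℂ) ^ (-((ν : ℂ) + (t : ℂ) * Complex.I))) * f y =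
      ∫ t : ℝ, K t * mellin f (1 - ((ν : ℂ) + (t : ℂ) * Complex.I)) := by
  have hint : Integrable (Function.uncurry fun (y t : ℝ) =>
      K t * (y : ℂ) ^ (-((ν : ℂ) + (t : ℂ) * Complex.I)) * f y)
      ((volume.restrict (Ioi (0 : ℝ))).prod volume) := by
    refine (hf.integrable.mul_prod hK.norm).mono' ?_ ?_
    · refine (hK.aestronglyMeasurable.comp_snd.mul ?_).mul hfm.comp_fst
      exact Measurable.aestronglyMeasurable (by fun_prop)
    · have hpos : ∀ᵐ z : ℝ × ℝ ∂((volume.restrict (Ioi (0 : ℝ))).prod volume), 0 < z.1 :=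
        Measure.quasiMeasurePreserving_fst.ae (ae_restrict_mem measurableSet_Ioi)
      filter_upwards [hpos] with z hz
      simp only [Function.uncurry, norm_mul, Complex.norm_cpow_eq_rpow_re_of_pos hz]
      simp only [Complex.neg_re, Complex.add_re, Complex.ofReal_re, Complex.mul_re,
        Complex.I_re, Complex.I_im, Complex.ofReal_im, mul_zero, zero_mul, sub_zero, add_zero]
      exact le_of_eq (by ring)
  simp_rw [← integral_mul_const]
  rw [integral_integral_swap hint]
  refine integral_congr_ae (Filter.Eventually.of_forall fun t => ?_)
  simp only [mellin, ← integral_const_mul, smul_eq_mul, mul_assoc]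
  refine setIntegral_congr_fun measurableSet_Ioi fun y _ => ?_
  congr 3
  ring

/-- Formula (2.10): `(F_μ f)(τ)` as a Mellin–Barnes integral along `Re s = ν + 1/2`
involving the Mellin transform `f*` of `f`. -/
theorem stmt6 (μ : ℂ) (hμ : μ.re < 1/2) (p q ν : ℝ)
    (hp : 1 < p) (hp2 : p ≤ 2) (hq : q = p / (p - 1))
    (hν : ν ∈ Set.Ioo (-(1 / (2 * q))) (min 0 (-μ.re)))
    (f : ℝ → ℂ) (hfm : AEStronglyMeasurable f (volume.restrict (Set.Ioi (0 : ℝ))))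
    (hf1 : IntegrableOn (fun y : ℝ => ‖f y‖ * y ^ (-ν)) (Set.Ioi (0 : ℝ)))
    (hf2 : IntegrableOn (fun y : ℝ => ‖f y‖ ^ p * y ^ ((1 - ν) * p - 1)) (Set.Ioi (0 : ℝ))) :
    ∀ τ : ℝ, Fmu μ ν f τ =
      (1 / (2 * Real.pi)) • ∫ t : ℝ,
        (fun s : ℂ =>
          Complex.Gamma (s + Complex.I * (τ : ℂ)) * Complex.Gamma (s - Complex.I * (τ : ℂ)) *
            Complex.Gamma s * Complex.Gamma (1/2 - μ - s) /
            (Complex.Gamma (1/2 + s) * Complex.Gamma (1/2 + s - μ)) *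
            mellin f (3/2 - s))
          ((ν : ℂ) + 1/2 + (t : ℂ) * Complex.I) := by
  obtain ⟨hν1, hν2⟩ := hν
  have hνμ : ν < -μ.re := hν2.trans_le (min_le_right _ _)
  have hq1 : 1 ≤ q := by
    rw [hq, le_div_iff₀ (by linarith)]
    linarith
  have hν0 : -(1/2) < ν := by
    refine lt_of_le_of_lt (neg_le_neg ?_) hν1
    exact one_div_le_one_div_of_le two_pos (by linarith)
  intro τ
  have key := integral_mul_cpow_mul_eq_integral_mul_mellin (integrable_Kker hν0 hνμ τ) hfm hf1
  simp only [Fmu, Phi, smul_mul_assoc, integral_smul]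
  rw [key]
  congr 1
  refine integral_congr_ae (Filter.Eventually.of_forall fun t => ?_)
  simp only [Kker]
  congr 2 <;> ring_nf
end

section
/- Let μ ∈ ℂ with Re μ < 1/2, ν ∈ (−1/2, −Re μ), g ∈ L₁(ℝ), and suppose that (G_μ g)(x) = ∫_ℝ Φ_τ(x) g(τ) dτ satisfies ∫₀^∞ |(G_μ g)(x)| x^{ν−1} dx < ∞ (i.e. G_μ g ∈ L_{ν,1}(ℝ₊)). Then for every s with Re s = ν the Mellin transform (G_μ g)*(s) = ∫₀^∞ (G_μ g)(x) x^{s−1} dx satisfies [Γ(1+s) Γ(1+s−μ) / (Γ(1/2+s) Γ(−μ−s))] (G_μ g)*(s) = ∫_ℝ Γ(s+1/2+iτ) Γ(s+1/2−iτ) g(τ) dτ. -/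
open MeasureTheory Set Complex

/-- The adjoint index transform `(G_μ g)(x) = ∫_ℝ Φ_τ(x) g(τ) dτ`. -/
noncomputable def Gmu (μ : ℂ) (γ : ℝ) (g : ℝ → ℂ) (x : ℝ) : ℂ :=
  ∫ τ : ℝ, Phi μ γ τ x * g τ

namespace Complex

theorem norm_Gamma_le {z : ℂ} (hz : 0 < z.re) : ‖Gamma z‖ ≤ Real.Gamma z.re := by
  rw [Gamma_eq_integral hz, Real.Gamma_eq_integral hz, GammaIntegral]
  refine (norm_integral_le_integral_norm _).trans_eq
    (setIntegral_congr_fun measurableSet_Ioi fun x (hx : 0 < x) ↦ ?_)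
  simp [norm_cpow_eq_rpow_re_of_pos hx, norm_exp]

/-- Two applications of the functional equation give quadratic decay of `Γ` on vertical lines. -/
theorem norm_Gamma_le_div_sq {z : ℂ} (hz : 0 < z.re) :
    ‖Gamma z‖ ≤ Real.Gamma (z.re + 2) / ‖z‖ ^ 2 := by
  have hz0 : z ≠ 0 := fun h ↦ by simp [h] at hz
  have hz1 : z + 1 ≠ 0 := fun h ↦ by
    have := congrArg re h
    simp at this
    linarith
  have hle : ‖z‖ ≤ ‖z + 1‖ := by
    rw [← sq_le_sq₀ (norm_nonneg _) (norm_nonneg _), ← normSq_eq_norm_sq, ← normSq_eq_norm_sq,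
      normSq_apply, normSq_apply]
    simp only [add_re, one_re, add_im, one_im]
    nlinarith
  have hG : Gamma (z + 2) = (z + 1) * z * Gamma z := by
    rw [mul_assoc, ← Gamma_add_one z hz0, ← Gamma_add_one _ hz1]
    ring_nf
  have hb := norm_Gamma_le (z := z + 2) (by simp; linarith)
  rw [hG, norm_mul, norm_mul] at hb
  rw [le_div_iff₀ (by positivity)]
  calc ‖Gamma z‖ * ‖z‖ ^ 2 ≤ ‖z + 1‖ * ‖z‖ * ‖Gamma z‖ := by
        rw [sq, mul_comm]; gcongr
    _ ≤ _ := by simpa using hb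

theorem norm_betaIntegral_le (u v : ℂ) :
    ‖betaIntegral u v‖ ≤ ∫ x in Ioo (0 : ℝ) 1, x ^ (u.re - 1) * (1 - x) ^ (v.re - 1) := by
  rw [betaIntegral, intervalIntegral.integral_of_le zero_le_one, integral_Ioc_eq_integral_Ioo]
  refine (norm_integral_le_integral_norm _).trans_eq
    (setIntegral_congr_fun measurableSet_Ioo fun x hx ↦ ?_)
  have h1 : (1 - (x : ℂ)) = ((1 - x : ℝ) : ℂ) := by simp
  simp only [norm_mul]
  rw [h1, norm_cpow_eq_rpow_re_of_pos hx.1, norm_cpow_eq_rpow_re_of_pos (sub_pos.2 hx.2)]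
  simp

/-- A product of two Gamma values is controlled by the Gamma value of the sum, with a constant
that depends on the real parts only. -/
theorem exists_norm_Gamma_mul_Gamma_le {a b : ℝ} (ha : 0 < a) (hb : 0 < b) :
    ∃ C, 0 ≤ C ∧ ∀ u v : ℂ, u.re = a → v.re = b →
      ‖Gamma u * Gamma v‖ ≤ C * ‖Gamma (u + v)‖ := by
  refine ⟨∫ x in Ioo (0 : ℝ) 1, x ^ (a - 1) * (1 - x) ^ (b - 1),
    setIntegral_nonneg measurableSet_Ioo fun x hx ↦ ?_, fun u v hu hv ↦ ?_⟩
  · have := hx.1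
    have := sub_pos.2 hx.2
    positivity
  · rw [Gamma_mul_Gamma_eq_betaIntegral (hu ▸ ha) (hv ▸ hb), norm_mul, mul_comm]
    have := norm_betaIntegral_le u v
    rw [hu, hv] at this
    gcongr

end Complex

section Kernel

variable {μ : ℂ} {ν : ℝ}

/-- The part of `Kker` that does not depend on the index `τ`. -/
noncomputable def Kfactor (μ s : ℂ) : ℂ :=
  Gamma (s + 1/2) * Gamma (-μ - s) / (Gamma (1 + s) * Gamma (1 + s - μ))

theorem Kker_eq (μ : ℂ) (τ : ℝ) (s : ℂ) :
    Kker μ τ s = Kfactor μ s * (Gamma (s + 1/2 + I * τ) * Gamma (s + 1/2 - I * τ)) := by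
  rw [Kker, Kfactor]
  ring

theorem exists_norm_Kker_le (hν : ν ∈ Ioo (-(1/2) : ℝ) (-μ.re)) :
    ∃ C, ∀ τ t : ℝ, ‖Kker μ τ (ν + t * I)‖ ≤ C * (1 + t ^ 2)⁻¹ := by
  obtain ⟨hν₁, hν₂⟩ := hν
  have hμ : μ.re < 1/2 := by linarith
  have ha : 0 < ν + 1/2 := by linarith
  obtain ⟨C₁, hC₁, h₁⟩ := exists_norm_Gamma_mul_Gamma_le ha ha
  obtain ⟨C₂, hC₂, h₂⟩ := exists_norm_Gamma_mul_Gamma_le ha (sub_pos.2 hμ)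
  set m := min ((ν + 1/2) ^ 2) 1
  have hm0 : 0 < m := lt_min (by positivity) one_pos
  set D := Real.Gamma (ν + 1/2 + 2) with hD
  have hD0 : 0 < D := Real.Gamma_pos_of_pos (by linarith)
  have hG0 : 0 < ‖Gamma (1/2 - μ)‖ := norm_pos_iff.2 (Gamma_ne_zero_of_re_pos (by simpa using hμ))
  refine ⟨C₁ * (2 ^ (2 * ν) / √Real.pi) * (C₂ / ‖Gamma (1/2 - μ)‖) * Real.Gamma (-μ.re - ν) *
    (D / m), fun τ t ↦ ?_⟩
  set s : ℂ := ν + t * I with hs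
  have hsre : s.re = ν := by simp [hs]
  have hsim : s.im = t := by simp [hs]
  have hne₁ : Gamma (1 + s) ≠ 0 := Gamma_ne_zero_of_re_pos (by simp [hsre]; linarith)
  have hne₂ : Gamma (1 + s - μ) ≠ 0 := Gamma_ne_zero_of_re_pos (by simp [hsre]; linarith)
  have b₁ := h₁ (s + 1/2 + I * τ) (s + 1/2 - I * τ) (by simp [hsre]) (by simp [hsre])
  have b₂ := h₂ (s + 1/2) (1/2 - μ) (by simp [hsre]) (by simp)
  have b₃ : ‖Gamma (-μ - s)‖ ≤ Real.Gamma (-μ.re - ν) := by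
    simpa [hsre] using norm_Gamma_le (z := -μ - s) (by simp [hsre]; linarith)
  have b₄ : ‖Gamma (s + 1/2)‖ ≤ D / m * (1 + t ^ 2)⁻¹ := by
    have h := norm_Gamma_le_div_sq (z := s + 1/2) (by simp [hsre]; linarith)
    have hre : (s + 1/2).re = ν + 1/2 := by simp [hsre]
    have him : (s + 1/2).im = t := by simp [hsim]
    rw [hre, ← hD, ← normSq_eq_norm_sq, normSq_apply, hre, him] at h
    refine h.trans ?_
    rw [← div_eq_mul_inv, div_div]
    gcongr
    nlinarith [min_le_left ((ν + 1/2) ^ 2) 1, min_le_right ((ν + 1/2) ^ 2) 1, sq_nonneg t]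
  have hdup : ‖Gamma (2 * s + 1)‖ =
      2 ^ (2 * ν) / √Real.pi * (‖Gamma (s + 1/2)‖ * ‖Gamma (1 + s)‖) := by
    have h := congrArg norm (Gamma_mul_Gamma_add_half (s + 1/2))
    have hpi : 0 < √Real.pi := Real.sqrt_pos.2 Real.pi_pos
    have e₁ : s + 1/2 + 1/2 = 1 + s := by ring
    have e₂ : 2 * (s + 1/2) = 2 * s + 1 := by ring
    have e₃ : ‖(2 : ℂ) ^ (1 - (2 * s + 1))‖ = (2 ^ (2 * ν))⁻¹ := by
      rw [show (2 : ℂ) = ((2 : ℝ) : ℂ) by simp, norm_cpow_eq_rpow_re_of_pos two_pos,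
        ← Real.rpow_neg two_pos.le]
      simp [hsre]
    rw [e₁, e₂, norm_mul, norm_mul, norm_mul, e₃, norm_real, Real.norm_of_nonneg hpi.le] at h
    rw [h]
    field_simp
  have e : s + 1/2 + I * τ + (s + 1/2 - I * τ) = 2 * s + 1 := by ring
  rw [e, hdup] at b₁
  have b₂' : ‖Gamma (s + 1/2)‖ / ‖Gamma (1 + s - μ)‖ ≤ C₂ / ‖Gamma (1/2 - μ)‖ := by
    rw [div_le_div_iff₀ (norm_pos_iff.2 hne₂) hG0, ← norm_mul]
    rwa [show s + 1/2 + (1/2 - μ) = 1 + s - μ by ring] at b₂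
  have hB : 0 < Real.Gamma (-μ.re - ν) := Real.Gamma_pos_of_pos (by linarith)
  rw [Kker_eq, Kfactor, norm_mul, norm_div, norm_mul, norm_mul]
  calc _ ≤ ‖Gamma (s + 1/2)‖ * ‖Gamma (-μ - s)‖ / (‖Gamma (1 + s)‖ * ‖Gamma (1 + s - μ)‖) *
        (C₁ * (2 ^ (2 * ν) / √Real.pi * (‖Gamma (s + 1/2)‖ * ‖Gamma (1 + s)‖))) := by gcongr
    _ = C₁ * (2 ^ (2 * ν) / √Real.pi) * (‖Gamma (s + 1/2)‖ / ‖Gamma (1 + s - μ)‖) *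
        ‖Gamma (-μ - s)‖ * ‖Gamma (s + 1/2)‖ := by
      have := norm_ne_zero_iff.2 hne₁
      field_simp
    _ ≤ C₁ * (2 ^ (2 * ν) / √Real.pi) * (C₂ / ‖Gamma (1/2 - μ)‖) *
        Real.Gamma (-μ.re - ν) * (D / m * (1 + t ^ 2)⁻¹) := by gcongr
    _ = _ := by ring

theorem continuous_Kker (hν : ν ∈ Ioo (-(1/2) : ℝ) (-μ.re)) :
    Continuous fun p : ℝ × ℝ ↦ Kker μ p.1 (ν + p.2 * I) := by
  obtain ⟨hν₁, hν₂⟩ := hν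
  have key : ∀ f : ℝ × ℝ → ℂ, Continuous f → (∀ p, 0 < (f p).re) →
      Continuous fun p ↦ Gamma (f p) := fun f hf hpos ↦
    continuous_iff_continuousAt.2 fun p ↦ ContinuousAt.comp
      (differentiableAt_Gamma _ fun m hm ↦ by
        have h := hpos p
        rw [hm] at h
        simp at h
        linarith [(Nat.cast_nonneg m : (0 : ℝ) ≤ m)]).continuousAt hf.continuousAt
  unfold Kker
  refine Continuous.div ?_ ?_ fun p ↦ mul_ne_zero ?_ ?_
  · refine (((key _ ?_ ?_).mul (key _ ?_ ?_)).mul (key _ ?_ ?_)).mul (key _ ?_ ?_) <;>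
    first | fun_prop | (intro p; simp; linarith)
  · refine (key _ ?_ ?_).mul (key _ ?_ ?_) <;>
    first | fun_prop | (intro p; simp; linarith)
  · exact Gamma_ne_zero_of_re_pos (by simp; linarith)
  · exact Gamma_ne_zero_of_re_pos (by simp; linarith)

variable {g : ℝ → ℂ}

theorem integrable_Kker_mul (hν : ν ∈ Ioo (-(1/2) : ℝ) (-μ.re)) (hg : Integrable g) :
    Integrable (fun p : ℝ × ℝ ↦ Kker μ p.1 (ν + p.2 * I) * g p.1) (volume.prod volume) := by
  obtain ⟨C, hC⟩ := exists_norm_Kker_le hν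
  refine (hg.norm.mul_prod (integrable_inv_one_add_sq.const_mul C)).mono'
    ((continuous_Kker hν).aestronglyMeasurable.mul hg.aestronglyMeasurable.comp_fst)
    (.of_forall fun p ↦ ?_)
  rw [norm_mul, mul_comm]
  gcongr
  exact hC _ _

theorem continuous_integral_Kker_mul (hν : ν ∈ Ioo (-(1/2) : ℝ) (-μ.re)) (hg : Integrable g) :
    Continuous fun t : ℝ ↦ ∫ τ : ℝ, Kker μ τ (ν + t * I) * g τ := by
  obtain ⟨C, hC⟩ := exists_norm_Kker_le hν
  have hcont := continuous_Kker hν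
  have hC₀ : 0 ≤ C := by simpa using (norm_nonneg _).trans (hC 0 0)
  refine continuous_of_dominated (bound := fun τ ↦ C * ‖g τ‖) (fun t ↦ ?_)
    (fun t ↦ .of_forall fun τ ↦ ?_) (hg.norm.const_mul C) (.of_forall fun τ ↦ ?_)
  · exact (hcont.comp (.prodMk_left t)).aestronglyMeasurable.mul hg.aestronglyMeasurable
  · rw [norm_mul]
    gcongr
    refine (hC τ t).trans (mul_le_of_le_one_right hC₀ (inv_le_one_of_one_le₀ ?_))
    linarith [sq_nonneg t]
  · exact (hcont.comp (.prodMk_right τ)).mul continuous_const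

open scoped FourierTransform in
theorem exp_smul_Gmu_eq_fourierInv (hν : ν ∈ Ioo (-(1/2) : ℝ) (-μ.re)) (hg : Integrable g)
    (u : ℝ) :
    Real.exp (-ν * u) • Gmu μ ν g (Real.exp (-u)) =
      𝓕⁻ (fun y : ℝ ↦ ∫ τ : ℝ, Kker μ τ (ν + (2 * Real.pi * y : ℝ) * I) * g τ) u := by
  have hpow : ∀ t : ℝ, ((Real.exp (-u) : ℝ) : ℂ) ^ (-(ν + t * I)) =
      exp (ν * u) * exp (t * u * I) := fun t ↦ by
    rw [cpow_def_of_ne_zero (by simp [exp_ne_zero]), ← ofReal_log (Real.exp_pos _).le, Real.log_exp,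
      ← exp_add]
    push_cast
    ring_nf
  have hint : Integrable (fun p : ℝ × ℝ ↦
      exp (p.2 * u * I) * (Kker μ p.1 (ν + p.2 * I) * g p.1)) (volume.prod volume) := by
    refine (integrable_Kker_mul hν hg).bdd_mul (c := 1)
      (by fun_prop : Continuous fun p : ℝ × ℝ ↦ exp (p.2 * u * I)).aestronglyMeasurable
      (.of_forall fun p ↦ ?_)
    rw [← ofReal_mul, norm_exp_ofReal_mul_I]
  have hG : Gmu μ ν g (Real.exp (-u)) = (2 * Real.pi)⁻¹ • (exp (ν * u) *
      ∫ t : ℝ, exp (t * u * I) * ∫ τ : ℝ, Kker μ τ (ν + t * I) * g τ) := by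
    simp_rw [← integral_const_mul]
    rw [← integral_integral_swap (f := fun τ t : ℝ ↦
      exp (ν * u) * (exp (t * u * I) * (Kker μ τ (ν + t * I) * g τ))) (hint.const_mul _),
      ← integral_smul]
    refine integral_congr_ae (.of_forall fun τ ↦ ?_)
    simp only [Phi, hpow, one_div, smul_mul_assoc, ← integral_mul_const]
    congr! 3
    ring
  rw [hG, Real.fourierInv_eq', real_smul, real_smul]
  have hcov := Measure.integral_comp_mul_left
    (fun t : ℝ ↦ exp (t * u * I) * ∫ τ : ℝ, Kker μ τ (ν + t * I) * g τ) (2 * Real.pi)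
  rw [abs_of_pos (by positivity), real_smul] at hcov
  calc _ = ((2 * Real.pi)⁻¹ : ℝ) *
        ∫ t : ℝ, exp (t * u * I) * ∫ τ : ℝ, Kker μ τ (ν + t * I) * g τ := by
        have : ((Real.exp (-ν * u) : ℝ) : ℂ) * exp (ν * u) = 1 := by
          rw [ofReal_exp, ← exp_add]
          simp
        linear_combination ((2 * Real.pi)⁻¹ : ℝ) *
          (∫ t : ℝ, exp (t * u * I) * ∫ τ : ℝ, Kker μ τ (ν + t * I) * g τ) * this
    _ = _ := by
        rw [← hcov]
        refine integral_congr_ae (.of_forall fun y ↦ ?_)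
        simp only [smul_eq_mul, RCLike.inner_apply, conj_trivial]
        congr 2
        push_cast
        ring

theorem integrable_exp_smul_comp_exp_neg {f : ℝ → ℂ}
    (hf : IntegrableOn (fun x : ℝ ↦ ‖f x‖ * x ^ (ν - 1)) (Ioi 0)) :
    Integrable fun u : ℝ ↦ ‖Real.exp (-ν * u) • f (Real.exp (-u))‖ := by
  have himage : image (fun u : ℝ ↦ Real.exp (-u)) univ = Ioi 0 := by
    rw [image_univ, ← Real.range_exp]
    exact neg_surjective.range_comp Real.exp
  rw [← himage, integrableOn_image_iff_integrableOn_abs_deriv_smul MeasurableSet.univ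
    (fun u _ ↦ ((hasDerivAt_neg u).exp).hasDerivWithinAt)
    (Real.exp_injective.comp neg_injective).injOn, integrableOn_univ] at hf
  refine hf.congr (.of_forall fun u ↦ ?_)
  have hexp : Real.exp (-u) * Real.exp (-u) ^ (ν - 1) = Real.exp (-ν * u) := by
    rw [← Real.exp_mul, ← Real.exp_add]
    ring_nf
  simp only [mul_neg, mul_one, abs_neg, Real.abs_exp, smul_eq_mul, norm_smul, Real.norm_eq_abs]
  rw [← hexp]
  ring

open scoped FourierTransform in
theorem mellin_Gmu (hν : ν ∈ Ioo (-(1/2) : ℝ) (-μ.re)) (hg : Integrable g)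
    (hG : IntegrableOn (fun x : ℝ ↦ ‖Gmu μ ν g x‖ * x ^ (ν - 1)) (Ioi 0)) (t : ℝ) :
    mellin (Gmu μ ν g) (ν + t * I) = ∫ τ : ℝ, Kker μ τ (ν + t * I) * g τ := by
  set F : ℝ → ℂ := fun y ↦ ∫ τ : ℝ, Kker μ τ (ν + (2 * Real.pi * y : ℝ) * I) * g τ with hF
  have hFc : Continuous F := (continuous_integral_Kker_mul hν hg).comp (by fun_prop)
  have hFi : Integrable F := (integrable_Kker_mul hν hg).integral_prod_right.comp_mul_left'
    (by positivity : 2 * Real.pi ≠ 0)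
  have hinv : (fun u : ℝ ↦ Real.exp (-ν * u) • Gmu μ ν g (Real.exp (-u))) = 𝓕⁻ F :=
    funext (exp_smul_Gmu_eq_fourierInv hν hg)
  have hnorm : Integrable fun u ↦ ‖(𝓕⁻ F) u‖ := by
    rw [← hinv]
    exact integrable_exp_smul_comp_exp_neg hG
  have hFTi : Integrable (𝓕 F) := by
    have hc : Continuous (𝓕 F) := VectorFourier.fourierIntegral_continuous
      Real.continuous_fourierChar (by exact continuous_inner) hFi
    refine (integrable_norm_iff hc.aestronglyMeasurable).1 (hnorm.comp_neg.congr ?_)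
    exact .of_forall fun u ↦ by simp [Real.fourierInv_eq_fourier_neg]
  have hre : ((ν : ℂ) + t * I).re = ν := by simp
  have him : ((ν : ℂ) + t * I).im = t := by simp
  rw [mellin_eq_fourier, hre, him, hinv, hFc.fourier_fourierInv_eq hFi hFTi]
  simp only [hF]
  rw [mul_div_cancel₀ t (by positivity : 2 * Real.pi ≠ 0)]

end Kernel

/-- Formula (3.3): the Mellin transform of `G_μ g` on the line `Re s = ν`. -/
theorem stmt11 (μ : ℂ) (hμ : μ.re < 1/2) (ν : ℝ)
    (hν : ν ∈ Set.Ioo (-(1/2) : ℝ) (-μ.re))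
    (g : ℝ → ℂ) (hg : Integrable g)
    (hG : IntegrableOn (fun x : ℝ => ‖Gmu μ ν g x‖ * x ^ (ν - 1)) (Set.Ioi (0 : ℝ))) :
    ∀ t : ℝ,
      (fun s : ℂ =>
        Complex.Gamma (1 + s) * Complex.Gamma (1 + s - μ) /
          (Complex.Gamma (1/2 + s) * Complex.Gamma (-μ - s)) *
          mellin (Gmu μ ν g) s) ((ν : ℂ) + (t : ℂ) * Complex.I) =
      ∫ τ : ℝ,
        Complex.Gamma (((ν : ℂ) + (t : ℂ) * Complex.I) + 1/2 + Complex.I * (τ : ℂ)) *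
          Complex.Gamma (((ν : ℂ) + (t : ℂ) * Complex.I) + 1/2 - Complex.I * (τ : ℂ)) *
          g τ := by
  intro t
  have hmellin := mellin_Gmu hν hg hG t
  obtain ⟨hν₁, hν₂⟩ := hν
  dsimp only
  rw [hmellin]
  set s : ℂ := (ν : ℂ) + t * I with hs
  have hsre : s.re = ν := by simp [hs]
  have h₁ : Gamma (1 + s) ≠ 0 := Gamma_ne_zero_of_re_pos (by simp [hsre]; linarith)
  have h₂ : Gamma (1 + s - μ) ≠ 0 := Gamma_ne_zero_of_re_pos (by simp [hsre]; linarith)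
  have h₃ : Gamma (1/2 + s) ≠ 0 := Gamma_ne_zero_of_re_pos (by simp [hsre]; linarith)
  have h₄ : Gamma (-μ - s) ≠ 0 := Gamma_ne_zero_of_re_pos (by simp [hsre]; linarith)
  have hfactor : Gamma (1 + s) * Gamma (1 + s - μ) / (Gamma (1/2 + s) * Gamma (-μ - s)) *
      Kfactor μ s = 1 := by
    rw [Kfactor, add_comm s (1/2), div_mul_div_comm, mul_comm, div_self (by positivity)]
  rw [← integral_const_mul]
  refine integral_congr_ae (.of_forall fun τ ↦ ?_)
  dsimp only
  rw [Kker_eq, ← mul_assoc, ← mul_assoc, hfactor, one_mul]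
end
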